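/- Let F ∈ 𝓔^m be essentially smooth. Then for every S ∈ S^m_+ and every L̄ ∈ 𝕃^m_+ there exists a unique positive definite matrix Σ̂ ∈ S^m_+ that agrees with S on the A-entries (Σ̂_A = S_A) and such that L̂ := ∇F(Σ̂) agrees with L̄ on the B-entries (L̂_B = L̄_B). -/

import Mathlib

open Matrix Filter Topology

namespace Entropic

abbrev Mat (m : ℕ) := Matrix (Fin m) (Fin m) ℝ

variable {m : ℕ}

/-- The trace inner product `⟨A,B⟩ = tr(AB)` on matrices. -/
noncomputable def ip (A B : Mat m) : ℝ := (A * B).trace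

/-- The Frobenius norm `‖A‖_F = √tr(AAᵀ)`. -/
noncomputable def fnorm (A : Mat m) : ℝ := Real.sqrt (ip A Aᵀ)

/-- The class `𝓔^m`: proper convex lower semicontinuous `F : S^m → ℝ ∪ {+∞}` with
`S^m_+ ⊆ dom F ⊆ cl(S^m_+)` which is strictly convex and continuously differentiable on
`S^m_+`; the (trace-inner-product) gradient on `S^m_+` is bundled as `grad`. -/
structure EClass (m : ℕ) where
  F : Mat m → EReal
  grad : Mat m → Mat m
  F_ne_bot : ∀ A : Mat m, F A ≠ ⊥
  convex : ∀ x y : Mat m, x.IsHermitian → y.IsHermitian → ∀ a b : ℝ,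
    0 ≤ a → 0 ≤ b → a + b = 1 →
    F (a • x + b • y) ≤ (a : EReal) * F x + (b : EReal) * F y
  lsc : LowerSemicontinuousOn F {A : Mat m | A.IsHermitian}
  posDef_mem_dom : ∀ A : Mat m, A.PosDef → F A ≠ ⊤
  dom_subset_psd : ∀ A : Mat m, F A ≠ ⊤ → A.PosSemidef
  strictConvex : ∀ x y : Mat m, x.PosDef → y.PosDef → x ≠ y → ∀ a b : ℝ,
    0 < a → 0 < b → a + b = 1 →
    F (a • x + b • y) < (a : EReal) * F x + (b : EReal) * F y
  grad_isHermitian : ∀ P : Mat m, P.PosDef → (grad P).IsHermitian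
  hasGradAt : ∀ P : Mat m, P.PosDef → ∀ H : Mat m, H.IsHermitian →
    HasDerivAt (fun t : ℝ => (F (P + t • H)).toReal) (ip (grad P) H) 0
  grad_continuousOn : ContinuousOn grad {A : Mat m | A.PosDef}

/-- `𝕃^m_+ = ∇F(S^m_+)`. -/
def Lplus (E : EClass m) : Set (Mat m) := E.grad '' {A : Mat m | A.PosDef}

/-- The Fenchel conjugate `F*(L) = sup_{Σ ∈ S^m} (⟨Σ,L⟩ − F(Σ))`. -/
noncomputable def conj (E : EClass m) (L : Mat m) : EReal :=
  ⨆ S : {A : Mat m // A.IsHermitian}, ((ip (S : Mat m) L : EReal) - E.F (S : Mat m))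

/-- `g_n(L) = −F*(L) + ⟨L, S_n⟩`. -/
noncomputable def gn (E : EClass m) (Sn L : Mat m) : EReal :=
  -(conj E L) + (ip L Sn : EReal)

/-- A set `U ⊆ S^m` is (relatively) open in `S^m`. -/
def RelOpen (U : Set (Mat m)) : Prop :=
  U ⊆ {A : Mat m | A.IsHermitian} ∧
    ∀ L ∈ U, ∃ ε > 0, ∀ M : Mat m, M.IsHermitian → fnorm (M - L) < ε → M ∈ U

/-- The affine subspace `A₀ + V` of `S^m`. -/
def affSet (A0 : Mat m) (V : Submodule ℝ (Mat m)) : Set (Mat m) :=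
  {L : Mat m | L - A0 ∈ V}

/-- The orthogonal complement in `S^m` (w.r.t. the trace inner product) of the linear
subspace `V`. -/
def perp (V : Submodule ℝ (Mat m)) : Set (Mat m) :=
  {W : Mat m | W.IsHermitian ∧ ∀ U ∈ V, ip W U = 0}


/-- `F ∈ 𝓔^m` is essentially smooth. -/
def EssSmooth {m : ℕ} (E : EClass m) : Prop :=
  ∀ (P : ℕ → Mat m) (B : Mat m), (∀ k, (P k).PosDef) → Tendsto P atTop (𝓝 B) →
    B.PosSemidef → ¬ B.PosDef → Tendsto (fun k => fnorm (E.grad (P k))) atTop atTop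

/-- The component of a symmetric matrix corresponding to a set `s` of entry positions:
entries outside `s` are replaced by `0`. -/
noncomputable def comp {m : ℕ} (s : Set (Fin m × Fin m)) (P : Mat m) : Mat m :=
  fun i j => s.indicator (fun q => P q.1 q.2) (i, j)

lemma ip_eq_sum (A B : Mat m) : ip A B = ∑ i, ∑ j, A i j * B j i := by
  simp [ip, Matrix.trace, Matrix.mul_apply]

lemma ip_add_right (A B C : Mat m) : ip A (B + C) = ip A B + ip A C := by
  simp [ip, Matrix.mul_add]

lemma ip_sub_right (A B C : Mat m) : ip A (B - C) = ip A B - ip A C := by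
  simp [ip, Matrix.mul_sub]

lemma ip_sub_left (A B C : Mat m) : ip (A - B) C = ip A C - ip B C := by
  simp [ip, Matrix.sub_mul]

lemma ip_smul_right (c : ℝ) (A B : Mat m) : ip A (c • B) = c * ip A B := by
  simp [ip]

lemma continuous_ip : Continuous fun p : Mat m × Mat m => ip p.1 p.2 :=
  (continuous_fst.matrix_mul continuous_snd).matrix_trace

lemma isClosed_isHermitian : IsClosed {A : Mat m | A.IsHermitian} :=
  isClosed_eq continuous_id.matrix_conjTranspose continuous_id

lemma isHermitian_smul {A : Mat m} (hA : A.IsHermitian) (c : ℝ) : (c • A).IsHermitian := by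
  rw [Matrix.IsHermitian, Matrix.conjTranspose_smul, hA.eq, star_trivial]

lemma isHermitian_apply {A : Mat m} (hA : A.IsHermitian) (i j : Fin m) : A i j = A j i := by
  simpa using hA.apply j i

lemma fnorm_sq {A : Mat m} (hA : A.IsHermitian) : fnorm A ^ 2 = ip A A := by
  have hT : Aᵀ = A := by
    rw [← Matrix.conjTranspose_eq_transpose_of_trivial, hA.eq]
  rw [fnorm, hT, Real.sq_sqrt]
  rw [ip_eq_sum]
  refine Finset.sum_nonneg fun i _ => Finset.sum_nonneg fun j _ => ?_
  rw [isHermitian_apply hA j i]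
  exact mul_self_nonneg _

lemma abs_apply_le_fnorm {A : Mat m} (hA : A.IsHermitian) (i j : Fin m) :
    |A i j| ≤ fnorm A := by
  refine abs_le_of_sq_le_sq ?_ (Real.sqrt_nonneg _)
  rw [fnorm_sq hA, ip_eq_sum]
  have h : ∀ i j, A i j * A j i = A i j ^ 2 := fun i j => by
    rw [isHermitian_apply hA j i, sq]
  simp only [h]
  calc A i j ^ 2 ≤ ∑ j, A i j ^ 2 :=
        Finset.single_le_sum (f := fun j => A i j ^ 2) (fun _ _ => sq_nonneg _) (Finset.mem_univ j)
    _ ≤ _ := Finset.single_le_sum (f := fun i => ∑ j, A i j ^ 2)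
        (fun _ _ => Finset.sum_nonneg fun _ _ => sq_nonneg _) (Finset.mem_univ i)

lemma comp_eq_comp_iff (s : Set (Fin m × Fin m)) (A B : Mat m) :
    comp s A = comp s B ↔ ∀ i j, (i, j) ∈ s → A i j = B i j := by
  constructor
  · intro h i j hij
    simpa [comp, hij] using congrFun (congrFun h i) j
  · intro h
    ext i j
    by_cases hij : (i, j) ∈ s
    · simp [comp, hij, h i j hij]
    · simp [comp, hij]

lemma isClosed_comp_eq (s : Set (Fin m × Fin m)) (S : Mat m) :
    IsClosed {A : Mat m | comp s A = comp s S} := by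
  simp only [comp_eq_comp_iff, Set.ofPred_forall]
  exact isClosed_iInter fun i => isClosed_iInter fun j => isClosed_iInter fun _ =>
    isClosed_eq (continuous_id.matrix_elem i j) continuous_const

lemma continuousOn_ip_grad_add (E : EClass m) (S : Mat m) {K : Set (Mat m)}
    (hK : ∀ H ∈ K, (S + H).PosDef) : ContinuousOn (fun H => ip (E.grad (S + H)) H) K := by
  have hg : ContinuousOn (fun H => E.grad (S + H)) K :=
    ContinuousOn.comp (t := {A | A.PosDef}) E.grad_continuousOn
      (continuous_const.add continuous_id).continuousOn hK
  exact Continuous.comp_continuousOn (g := fun p : Mat m × Mat m => ip p.1 p.2)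
    (f := fun H => (E.grad (S + H), H)) continuous_ip (hg.prodMk continuousOn_id)

section Norm

attribute [local instance] Matrix.normedAddCommGroup Matrix.normedSpace

lemma properSpace_mat : ProperSpace (Mat m) := FiniteDimensional.proper ℝ _

attribute [local instance] properSpace_mat

lemma exists_posDef_add {P : Mat m} (hP : P.PosDef) :
    ∃ r > 0, ∀ H : Mat m, H.IsHermitian → ‖H‖ ≤ r → (P + H).PosDef := by
  have hcont : Continuous fun p : Mat m × (Fin m → ℝ) => p.2 ⬝ᵥ ((P + p.1) *ᵥ p.2) :=
    continuous_snd.dotProduct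
      ((continuous_const.add continuous_fst).matrix_mulVec continuous_snd)
  have hev : ∀ᶠ H in 𝓝 (0 : Mat m), ∀ x ∈ Metric.sphere (0 : Fin m → ℝ) 1,
      0 < x ⬝ᵥ ((P + H) *ᵥ x) := by
    refine (isCompact_sphere _ _).eventually_forall_of_forall_eventually fun x hx => ?_
    refine hcont.continuousAt.eventually (lt_mem_nhds ?_)
    have hx0 : x ≠ 0 := by
      rintro rfl
      simp at hx
    simpa using hP.dotProduct_mulVec_pos hx0
  obtain ⟨ε, hε, h⟩ := Metric.eventually_nhds_iff.1 hev
  refine ⟨ε / 2, by positivity, fun H hH hr => ?_⟩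
  refine Matrix.PosDef.of_dotProduct_mulVec_pos (hP.isHermitian.add hH) fun x hx => ?_
  have hn : 0 < ‖x‖ := norm_pos_iff.2 hx
  have := h (y := H) (by rw [dist_zero_right]; linarith) (‖x‖⁻¹ • x)
    (by simp [norm_smul, hn.ne'])
  simp only [Matrix.mulVec_smul, smul_dotProduct, dotProduct_smul, smul_eq_mul] at this
  have hi : 0 < ‖x‖⁻¹ := inv_pos.2 hn
  simpa using (pos_of_mul_pos_right (pos_of_mul_pos_right this hi.le) hi.le)

namespace EClass

variable (E : EClass m)

/-- The finite part of `F`, as a real-valued function. -/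
noncomputable def realF (A : Mat m) : ℝ := (E.F A).toReal

variable {E}

lemma coe_realF {A : Mat m} (hA : E.F A ≠ ⊤) : ((E.realF A : ℝ) : EReal) = E.F A :=
  EReal.coe_toReal hA (E.F_ne_bot A)

lemma realF_segment_le {P Q : Mat m} (hP : P.IsHermitian) (hQ : Q.IsHermitian)
    (hFP : E.F P ≠ ⊤) (hFQ : E.F Q ≠ ⊤) {t : ℝ} (h0 : 0 ≤ t) (h1 : t ≤ 1) :
    E.F (P + t • (Q - P)) ≠ ⊤ ∧
      E.realF (P + t • (Q - P)) ≤ (1 - t) * E.realF P + t * E.realF Q := by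
  have h := E.convex P Q hP hQ (1 - t) t (by linarith) h0 (by ring)
  have he : (1 - t) • P + t • Q = P + t • (Q - P) := by module
  rw [he, ← coe_realF hFP, ← coe_realF hFQ, ← EReal.coe_mul, ← EReal.coe_mul,
    ← EReal.coe_add] at h
  have hne : E.F (P + t • (Q - P)) ≠ ⊤ := ne_top_of_le_ne_top (EReal.coe_ne_top _) h
  rw [← coe_realF hne, EReal.coe_le_coe_iff] at h
  exact ⟨hne, h⟩

lemma add_ip_grad_le {P Q : Mat m} (hP : P.PosDef) (hQ : Q.IsHermitian) (hFQ : E.F Q ≠ ⊤) :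
    E.realF P + ip (E.grad P) (Q - P) ≤ E.realF Q := by
  have hd := (E.hasGradAt P hP (Q - P) (hQ.sub hP.isHermitian)).tendsto_slope_zero_right
  have hle : ip (E.grad P) (Q - P) ≤ E.realF Q - E.realF P := by
    refine le_of_tendsto hd ?_
    filter_upwards [Ioc_mem_nhdsGT (zero_lt_one' ℝ)] with t ht
    have h := (realF_segment_le hP.isHermitian hQ (E.posDef_mem_dom P hP) hFQ ht.1.le ht.2).2
    simp only [zero_add, zero_smul, add_zero, smul_eq_mul]
    change t⁻¹ * (E.realF _ - E.realF P) ≤ _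
    rw [inv_mul_le_iff₀ ht.1]
    linarith
  linarith

lemma add_ip_grad_lt {P Q : Mat m} (hP : P.PosDef) (hQ : Q.PosDef) (hne : P ≠ Q) :
    E.realF P + ip (E.grad P) (Q - P) < E.realF Q := by
  have h := E.strictConvex P Q hP hQ hne (1 / 2) (1 / 2) (by norm_num) (by norm_num) (by norm_num)
  have hM : ((1 / 2 : ℝ) • P + (1 / 2 : ℝ) • Q).PosDef :=
    (hP.smul (by norm_num)).add (hQ.smul (by norm_num))
  have hFM := E.posDef_mem_dom _ hM
  rw [← coe_realF (E.posDef_mem_dom P hP), ← coe_realF (E.posDef_mem_dom Q hQ),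
    ← coe_realF hFM, ← EReal.coe_mul, ← EReal.coe_mul, ← EReal.coe_add,
    EReal.coe_lt_coe_iff] at h
  have h2 := add_ip_grad_le hP hM.isHermitian hFM
  have he : (1 / 2 : ℝ) • P + (1 / 2 : ℝ) • Q - P = (1 / 2 : ℝ) • (Q - P) := by module
  rw [he, ip_smul_right] at h2
  linarith

lemma exists_isMin_of_isCompact (L : Mat m) {K : Set (Mat m)} (hK : IsCompact K)
    (hKH : K ⊆ {A | A.IsHermitian}) {S : Mat m} (hS : S ∈ K) (hFS : E.F S ≠ ⊤) :
    ∃ P ∈ K, E.F P ≠ ⊤ ∧ ∀ Q ∈ K, E.F Q ≠ ⊤ →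
      E.realF P - ip L P ≤ E.realF Q - ip L Q := by
  have hlin : Continuous fun Q : Mat m => ((-ip L Q : ℝ) : EReal) :=
    continuous_coe_real_ereal.comp
      (continuous_ip.comp (continuous_const.prodMk continuous_id)).neg
  have hlsc : LowerSemicontinuousOn (fun Q => E.F Q + ((-ip L Q : ℝ) : EReal)) K :=
    (E.lsc.mono hKH).add' (hlin.lowerSemicontinuous.lowerSemicontinuousOn K) fun Q _ =>
      EReal.continuousAt_add (Or.inr (EReal.coe_ne_bot _)) (Or.inr (EReal.coe_ne_top _))
  obtain ⟨P, hPK, hP⟩ := hlsc.exists_isMinOn ⟨S, hS⟩ hK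
  have hFP : E.F P ≠ ⊤ := by
    intro htop
    have h : E.F P + ((-ip L P : ℝ) : EReal) ≤ E.F S + ((-ip L S : ℝ) : EReal) := hP hS
    rw [htop, EReal.top_add_coe, ← coe_realF hFS, ← EReal.coe_add] at h
    exact EReal.coe_ne_top _ (top_le_iff.1 h)
  refine ⟨P, hPK, hFP, fun Q hQ hFQ => ?_⟩
  have h : E.F P + ((-ip L P : ℝ) : EReal) ≤ E.F Q + ((-ip L Q : ℝ) : EReal) := hP hQ
  rw [← coe_realF hFP, ← coe_realF hFQ, ← EReal.coe_add, ← EReal.coe_add,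
    EReal.coe_le_coe_iff] at h
  linarith

lemma exists_linear_growth {P : Mat m} (hP : P.PosDef) :
    ∃ r > 0, ∃ δ > 0, ∀ Q : Mat m, Q.IsHermitian → E.F Q ≠ ⊤ → r ≤ ‖Q - P‖ →
      δ * ‖Q - P‖ ≤ E.realF Q - E.realF P - ip (E.grad P) (Q - P) := by
  obtain ⟨r, hr, hball⟩ := exists_posDef_add hP
  set K : Set (Mat m) := Metric.sphere P r ∩ {A | A.IsHermitian}
  have hK : IsCompact K := (isCompact_sphere _ _).inter_right isClosed_isHermitian
  have hKpos : ∀ Q ∈ K, Q.PosDef := fun Q hQ => by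
    have h := hball (Q - P) (hQ.2.sub hP.isHermitian) (by
      have := hQ.1
      rw [mem_sphere_iff_norm] at this
      exact this.le)
    rwa [add_sub_cancel] at h
  have hδ : ∃ δ > 0, ∀ Q ∈ K,
      δ ≤ E.realF Q - E.realF P - ip (E.grad P) (Q - P) := by
    rcases K.eq_empty_or_nonempty with h | ⟨S, hS⟩
    · exact ⟨1, one_pos, by simp [h]⟩
    · obtain ⟨T, hT, -, hmin⟩ := exists_isMin_of_isCompact (E := E) (E.grad P) hK
        Set.inter_subset_right hS (E.posDef_mem_dom S (hKpos S hS))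
      have hne : P ≠ T := by
        rintro rfl
        have := hT.1
        rw [mem_sphere_iff_norm, sub_self, norm_zero] at this
        exact hr.ne this
      refine ⟨E.realF T - E.realF P - ip (E.grad P) (T - P), ?_, fun Q hQ => ?_⟩
      · linarith [add_ip_grad_lt (E := E) hP (hKpos T hT) hne]
      · have := hmin Q hQ (E.posDef_mem_dom Q (hKpos Q hQ))
        rw [ip_sub_right, ip_sub_right]
        linarith
  obtain ⟨δ, hδ0, hδ⟩ := hδ
  refine ⟨r, hr, δ / r, by positivity, fun Q hQ hFQ hrQ => ?_⟩
  have hn : 0 < ‖Q - P‖ := hr.trans_le hrQ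
  set t := r / ‖Q - P‖ with ht
  have ht0 : 0 < t := by positivity
  have ht1 : t ≤ 1 := (div_le_one hn).2 hrQ
  have hseg := (realF_segment_le hP.isHermitian hQ (E.posDef_mem_dom P hP) hFQ ht0.le ht1).2
  have hmem : P + t • (Q - P) ∈ K := by
    refine ⟨?_, hP.isHermitian.add (isHermitian_smul (hQ.sub hP.isHermitian) t)⟩
    rw [mem_sphere_iff_norm, add_sub_cancel_left, norm_smul, Real.norm_of_nonneg ht0.le, ht,
      div_mul_cancel₀ _ hn.ne']
  have h := hδ _ hmem
  rw [add_sub_cancel_left, ip_smul_right] at h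
  have h2 : δ ≤ t * (E.realF Q - E.realF P - ip (E.grad P) (Q - P)) := by linarith
  calc δ / r * ‖Q - P‖ = δ / t := by rw [ht]; field_simp
    _ ≤ _ := (div_le_iff₀' ht0).2 h2

lemma exists_isMin_of_isClosed {P : Mat m} (hP : P.PosDef) {T : Set (Mat m)} (hT : IsClosed T)
    (hTH : T ⊆ {A | A.IsHermitian}) {S : Mat m} (hS : S ∈ T) (hFS : E.F S ≠ ⊤) :
    ∃ A ∈ T, E.F A ≠ ⊤ ∧ ∀ Q ∈ T, E.F Q ≠ ⊤ →
      E.realF A - ip (E.grad P) A ≤ E.realF Q - ip (E.grad P) Q := by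
  obtain ⟨r, hr, δ, hδ, hgrow⟩ := exists_linear_growth (E := E) hP
  set C := E.realF S - E.realF P - ip (E.grad P) (S - P) with hC
  set R := max r (max (C / δ) ‖S - P‖)
  have hSR : S ∈ Metric.closedBall P R ∩ T :=
    ⟨mem_closedBall_iff_norm.2 ((le_max_right _ _).trans (le_max_right _ _)), hS⟩
  obtain ⟨A, hA, hFA, hmin⟩ := exists_isMin_of_isCompact (E := E) (E.grad P)
    ((isCompact_closedBall P R).inter_right hT) (Set.inter_subset_right.trans hTH) hSR hFS
  refine ⟨A, hA.2, hFA, fun Q hQ hFQ => ?_⟩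
  by_cases hQR : ‖Q - P‖ ≤ R
  · exact hmin Q ⟨mem_closedBall_iff_norm.2 hQR, hQ⟩ hFQ
  · push Not at hQR
    have h1 := hgrow Q (hTH hQ) hFQ ((le_max_left _ _).trans hQR.le)
    have h2 : C / δ ≤ ‖Q - P‖ := ((le_max_left _ _).trans (le_max_right _ _)).trans hQR.le
    rw [div_le_iff₀' hδ] at h2
    have h3 := hmin S hSR hFS
    rw [ip_sub_right] at h1 hC
    linarith

lemma exists_realF_add_bound {S : Mat m} (hS : S.PosDef) :
    ∃ r > 0, ∃ C, ∀ H : Mat m, H.IsHermitian → ‖H‖ ≤ r →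
      (S + H).PosDef ∧ E.realF (S + H) ≤ C := by
  obtain ⟨r, hr, hball⟩ := exists_posDef_add hS
  set K : Set (Mat m) := Metric.closedBall 0 r ∩ {A | A.IsHermitian}
  have hK : IsCompact K := (isCompact_closedBall _ _).inter_right isClosed_isHermitian
  have hmem : ∀ H ∈ K, (S + H).PosDef := fun H hH =>
    hball H hH.2 (mem_closedBall_zero_iff.1 hH.1)
  obtain ⟨C, hC⟩ := hK.exists_bound_of_continuousOn (continuousOn_ip_grad_add E S hmem)
  refine ⟨r, hr, E.realF S + C, fun H hH hHr => ?_⟩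
  have hHK : H ∈ K := ⟨mem_closedBall_zero_iff.2 hHr, hH⟩
  refine ⟨hmem H hHK, ?_⟩
  have h := add_ip_grad_le (E := E) (hmem H hHK) hS.isHermitian (E.posDef_mem_dom S hS)
  have he : S - (S + H) = (-1 : ℝ) • H := by module
  rw [he, ip_smul_right] at h
  linarith [(Real.le_norm_self _).trans (hC H hHK)]

lemma mul_fnorm_le_of_ip_le {G : Mat m} (hG : G.IsHermitian) {r C : ℝ} (hr : 0 < r)
    (h : ∀ H : Mat m, H.IsHermitian → ‖H‖ ≤ r → ip G H ≤ C) : r * fnorm G ≤ C := by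
  have hn : 0 ≤ fnorm G := Real.sqrt_nonneg _
  rcases hn.eq_or_lt with h0 | h0
  · have := h 0 Matrix.isHermitian_zero (by simpa using hr.le)
    rw [← h0]
    simpa [ip] using this
  · have := h ((r / fnorm G) • G) (isHermitian_smul hG _) (by
      rw [norm_smul, Real.norm_of_nonneg (by positivity), div_mul_eq_mul_div, div_le_iff₀ h0]
      gcongr
      exact (Matrix.norm_le_iff hn).2 fun i j => abs_apply_le_fnorm hG i j)
    rw [ip_smul_right, ← fnorm_sq hG] at this
    calc r * fnorm G = r / fnorm G * fnorm G ^ 2 := by field_simp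
      _ ≤ C := this

lemma posDef_of_isMin_segment (hess : EssSmooth E) {S A L : Mat m} (hS : S.PosDef)
    (hA : A.PosSemidef) (hFA : E.F A ≠ ⊤)
    (hmin : ∀ t : ℝ, 0 < t → t ≤ 1 → E.realF A - ip L A ≤
      E.realF (A + t • (S - A)) - ip L (A + t • (S - A))) : A.PosDef := by
  by_contra hnot
  have hpos : ∀ t : ℝ, 0 < t → t ≤ 1 → (A + t • (S - A)).PosDef := fun t h0 h1 => by
    have he : A + t • (S - A) = t • S + (1 - t) • A := by module
    rw [he]
    exact (hS.smul h0).add_posSemidef (hA.smul (by linarith))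
  obtain ⟨r, hr, C, hC⟩ := exists_realF_add_bound (E := E) hS
  have hbound : ∀ t : ℝ, 0 < t → t ≤ 1 → r * fnorm (E.grad (A + t • (S - A))) ≤
      C - E.realF A - ip L (S - A) := fun t h0 h1 => by
    have hP := hpos t h0 h1
    refine mul_fnorm_le_of_ip_le (E.grad_isHermitian _ hP) hr fun H hH hHr => ?_
    obtain ⟨hSH, hle⟩ := hC H hH hHr
    have hm := hmin t h0 h1
    have hsub := add_ip_grad_le (E := E) hP hA.isHermitian hFA
    have hsub2 := add_ip_grad_le (E := E) hP hSH.isHermitian (E.posDef_mem_dom _ hSH)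
    have e1 : A - (A + t • (S - A)) = (-t) • (S - A) := by module
    have e2 : S + H - (A + t • (S - A)) = H + (1 - t) • (S - A) := by module
    rw [e1, ip_smul_right] at hsub
    rw [e2, ip_add_right, ip_smul_right] at hsub2
    rw [ip_add_right, ip_smul_right] at hm
    have hd : ip L (S - A) ≤ ip (E.grad (A + t • (S - A))) (S - A) :=
      le_of_mul_le_mul_left (by linarith) h0
    have hd2 := mul_le_mul_of_nonneg_left hd (sub_nonneg.2 h1)
    linarith
  have ht0 : ∀ k : ℕ, (0 : ℝ) < 1 / ((k : ℝ) + 1) := fun k => by positivity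
  have ht1 : ∀ k : ℕ, 1 / ((k : ℝ) + 1) ≤ 1 := fun k => by
    rw [div_le_one (by positivity)]
    linarith [k.cast_nonneg (α := ℝ)]
  have hlim : Tendsto (fun k : ℕ => A + (1 / ((k : ℝ) + 1)) • (S - A)) atTop (𝓝 A) := by
    simpa using tendsto_const_nhds.add
      ((tendsto_one_div_add_atTop_nhds_zero_nat (𝕜 := ℝ)).smul_const (S - A))
  have htop := hess _ A (fun k => hpos _ (ht0 k) (ht1 k)) hlim hA hnot
  obtain ⟨k, hk⟩ := (htop.eventually_gt_atTop ((C - E.realF A - ip L (S - A)) / r)).exists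
  rw [div_lt_iff₀' hr] at hk
  exact absurd (hbound _ (ht0 k) (ht1 k)) (not_le.2 hk)

lemma ip_grad_eq_of_isMin {A L H : Mat m} (hA : A.PosDef) (hH : H.IsHermitian)
    (hmin : ∀ t : ℝ, (A + t • H).PosDef →
      E.realF A - ip L A ≤ E.realF (A + t • H) - ip L (A + t • H)) :
    ip (E.grad A) H = ip L H := by
  obtain ⟨r, hr, hball⟩ := exists_posDef_add hA
  have hev : ∀ᶠ t : ℝ in 𝓝 0, ‖t • H‖ < r := by
    have hc : Continuous fun t : ℝ => ‖t • H‖ := (continuous_id.smul continuous_const).norm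
    exact hc.continuousAt.eventually (gt_mem_nhds (by simpa using hr))
  have hloc : IsLocalMin (fun t : ℝ => E.realF (A + t • H) - t * ip L H) 0 := by
    filter_upwards [hev] with t ht
    have h := hmin t (hball _ (isHermitian_smul hH t) ht.le)
    rw [ip_add_right, ip_smul_right] at h
    simp only [zero_smul, add_zero, zero_mul, sub_zero]
    linarith
  have hd := (E.hasGradAt A hA H hH).sub ((hasDerivAt_id (0 : ℝ)).mul_const (ip L H))
  have := hloc.hasDerivAt_eq_zero hd
  linarith

end EClass

end Norm

lemma ip_self_comp_eq_zero {s : Set (Fin m × Fin m)} {D : Mat m} (hD : D.IsHermitian)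
    (h : ip D (comp s D) = 0) (i j : Fin m) (hij : (i, j) ∈ s) : D i j = 0 := by
  classical
  have hterm : ∀ i j, D i j * comp s D j i = if (j, i) ∈ s then D j i ^ 2 else 0 := fun i j => by
    by_cases hji : (j, i) ∈ s
    · simp [comp, hji, isHermitian_apply hD i j, sq]
    · simp [comp, hji]
  have hnn : ∀ i j, 0 ≤ D i j * comp s D j i := fun i j => by
    rw [hterm]
    split_ifs <;> positivity
  rw [ip_eq_sum, Finset.sum_eq_zero_iff_of_nonneg
    fun i _ => Finset.sum_nonneg fun j _ => hnn i j] at h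
  have h' := (Finset.sum_eq_zero_iff_of_nonneg fun i _ => hnn j i).1
    (h j (Finset.mem_univ j)) i (Finset.mem_univ i)
  rw [hterm, if_pos hij] at h'
  exact pow_eq_zero_iff two_ne_zero |>.1 h'

lemma isHermitian_comp {s : Set (Fin m × Fin m)} (hs : ∀ i j : Fin m, (i, j) ∈ s ↔ (j, i) ∈ s)
    {D : Mat m} (hD : D.IsHermitian) : (comp s D).IsHermitian := by
  refine Matrix.IsHermitian.ext fun i j => ?_
  by_cases hij : (i, j) ∈ s
  · simp [comp, hij, (hs i j).1 hij, isHermitian_apply hD i j]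
  · simp [comp, hij, mt (hs i j).2 hij]

/-- variational independence, Corollary `cor:mixed`. Let `F ∈ 𝓔^m` be
essentially smooth and fix a symmetric set `s` of entry positions (the `A`-entries, whose
complement gives the `B`-entries). For every `S ∈ S^m_+` and every `L̄ ∈ 𝕃^m_+` there is
a unique positive definite `Σ̂` with `Σ̂_A = S_A` and `(∇F(Σ̂))_B = L̄_B`. -/
theorem variational_independence {m : ℕ} (E : EClass m) (hess : EssSmooth E)
    (s : Set (Fin m × Fin m)) (hs : ∀ i j : Fin m, (i, j) ∈ s ↔ (j, i) ∈ s)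
    (S : Mat m) (hS : S.PosDef) (Lbar : Mat m) (hLbar : Lbar ∈ Lplus E) :
    ∃! Shat : Mat m, Shat.PosDef ∧ comp s Shat = comp s S ∧
      comp sᶜ (E.grad Shat) = comp sᶜ Lbar := by
  obtain ⟨P, hP : P.PosDef, rfl⟩ := hLbar
  have hT : IsClosed ({A : Mat m | A.IsHermitian} ∩ {A | comp s A = comp s S}) :=
    isClosed_isHermitian.inter (isClosed_comp_eq s S)
  obtain ⟨A, hAT, hFA, hmin⟩ := EClass.exists_isMin_of_isClosed (E := E) hP hT
    Set.inter_subset_left ⟨hS.isHermitian, rfl⟩ (E.posDef_mem_dom S hS)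
  have hAS := (comp_eq_comp_iff s A S).1 hAT.2
  have hA : A.PosDef := by
    refine EClass.posDef_of_isMin_segment hess hS (E.dom_subset_psd A hFA) hFA (L := E.grad P)
      fun t h0 h1 => hmin _ ⟨?_, ?_⟩ ?_
    · exact hAT.1.add (isHermitian_smul (hS.isHermitian.sub hAT.1) t)
    · refine (comp_eq_comp_iff s _ S).2 fun i j hij => ?_
      simp [hAS i j hij]
    · exact (EClass.realF_segment_le hAT.1 hS.isHermitian hFA (E.posDef_mem_dom S hS) h0.le h1).1
  have hAL : ∀ i j, (i, j) ∈ sᶜ → E.grad A i j = E.grad P i j := by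
    have hD := (E.grad_isHermitian A hA).sub (E.grad_isHermitian P hP)
    have hsc : ∀ i j : Fin m, (i, j) ∈ sᶜ ↔ (j, i) ∈ sᶜ := fun i j => not_congr (hs i j)
    have hst := EClass.ip_grad_eq_of_isMin (E := E) (L := E.grad P) hA (isHermitian_comp hsc hD)
      fun t ht => hmin _ ⟨ht.isHermitian, (comp_eq_comp_iff s _ S).2 fun i j hij => by
        simp [comp, hij, hAS i j hij]⟩ (E.posDef_mem_dom _ ht)
    refine fun i j hij => sub_eq_zero.1 (ip_self_comp_eq_zero hD ?_ i j hij)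
    rw [ip_sub_left, hst, sub_self]
  refine ⟨A, ⟨hA, hAT.2, (comp_eq_comp_iff _ _ _).2 hAL⟩, ?_⟩
  · rintro Q ⟨hQ, hQS, hQL⟩
    by_contra hne
    have h1 := EClass.add_ip_grad_lt (E := E) hQ hA hne
    have h2 := EClass.add_ip_grad_lt (E := E) hA hQ (Ne.symm hne)
    have hQS' := (comp_eq_comp_iff s Q S).1 hQS
    have hst : ip (E.grad Q - E.grad A) (A - Q) = 0 := by
      rw [ip_eq_sum]
      refine Finset.sum_eq_zero fun i _ => Finset.sum_eq_zero fun j _ => ?_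
      by_cases hij : (i, j) ∈ s
      · have hji := (hs i j).1 hij
        simp [hAS j i hji, hQS' j i hji]
      · simp [hAL i j hij, (comp_eq_comp_iff _ _ _).1 hQL i j hij]
    rw [ip_sub_left, ip_sub_right, ip_sub_right] at hst
    rw [ip_sub_right] at h1 h2
    linarith

end Entropic
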